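/- For every integer k ≥ 1, the limit ν(k) := lim_{d→∞} (log₂ K(d,k))/d exists and equals 1. -/

import Mathlib

/-- Cyclic distance between two indices on a cycle of length `N`. -/
def cycDist {N : ℕ} (i j : ZMod N) : ℕ := min (j - i).val (i - j).val

/-- A `(d,k)` circuit code of length `N`: a simple cycle `x₁,…,x_N` in the
`d`-dimensional hypercube graph `I(d)` (vertices are binary vectors of length
`d`, adjacency is Hamming distance `1`, and the graph distance in `I(d)` equals
the Hamming distance) such that for any two vertices of the cycle the graph
distance is at least the minimum of their distance along the cycle and `k`. -/
def IsCircuitCode (d k N : ℕ) (x : ZMod N → (Fin d → Bool)) : Prop :=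
  3 ≤ N ∧ Function.Injective x ∧
    (∀ i : ZMod N, hammingDist (x i) (x (i + 1)) = 1) ∧
    (∀ i j : ZMod N, min (cycDist i j) k ≤ hammingDist (x i) (x j))

/-- `K d k`: the maximum length of a `(d,k)` circuit code. -/
noncomputable def K (d k : ℕ) : ℕ :=
  sSup {N | ∃ x : ZMod N → (Fin d → Bool), IsCircuitCode d k N x}

open scoped Finset

theorem hammingDist_eq_sum {ι : Type*} [Fintype ι] (x y : ι → Bool) :
    hammingDist x y = ∑ i, (x i ^^ y i).toNat := by
  rw [hammingDist, Finset.card_filter]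
  refine Finset.sum_congr rfl fun i _ => ?_
  cases x i <;> cases y i <;> rfl

theorem hammingDist_cons {n : ℕ} (a b : Bool) (x y : Fin n → Bool) :
    hammingDist (Fin.cons a x : Fin (n + 1) → Bool) (Fin.cons b y) =
      (a ^^ b).toNat + hammingDist x y := by
  simp [hammingDist_eq_sum, Fin.sum_univ_succ]

/-- One reflection step in the construction of the reflected Gray code. -/
def reflectGray {m : ℕ} (g : ℕ → Fin m → Bool) (i : ℕ) : Fin (m + 1) → Bool :=
  if i < 2 ^ m then Fin.cons false (g i) else Fin.cons true (g (2 ^ (m + 1) - 1 - i))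

theorem reflectGray_ne {m : ℕ} {g : ℕ → Fin m → Bool}
    (hg : ∀ i j, i < 2 ^ m → j < 2 ^ m → g i = g j → i = j) (i j : ℕ)
    (hi : i < 2 ^ (m + 1)) (hj : j < 2 ^ (m + 1)) (h : reflectGray g i = reflectGray g j) :
    i = j := by
  rw [pow_succ] at hi hj
  unfold reflectGray at h
  rw [pow_succ] at h
  split_ifs at h with h1 h2 h2
  · exact hg _ _ h1 h2 (Fin.cons_injective2 h).2
  · exact absurd (Fin.cons_injective2 h).1 (by simp)
  · exact absurd (Fin.cons_injective2 h).1 (by simp)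
  · have := hg _ _ (by omega) (by omega) (Fin.cons_injective2 h).2
    omega

theorem hammingDist_reflectGray {m : ℕ} {g : ℕ → Fin m → Bool}
    (hg : ∀ i, i + 1 < 2 ^ m → hammingDist (g i) (g (i + 1)) = 1) (i : ℕ)
    (hi : i + 1 < 2 ^ (m + 1)) :
    hammingDist (reflectGray g i) (reflectGray g (i + 1)) = 1 := by
  rw [pow_succ] at hi
  unfold reflectGray
  rw [pow_succ]
  split_ifs with h1 h2 h2
  · simp [hammingDist_cons, hg i h2]
  · have : 2 ^ m * 2 - 1 - (i + 1) = i := by omega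
    simp [hammingDist_cons, this]
  · omega
  · have h3 := hg (2 ^ m * 2 - 1 - (i + 1)) (by omega)
    have : 2 ^ m * 2 - 1 - (i + 1) + 1 = 2 ^ m * 2 - 1 - i := by omega
    rw [this, hammingDist_comm] at h3
    simp [hammingDist_cons, h3]

theorem hammingDist_reflectGray_last_first {m : ℕ} (g : ℕ → Fin m → Bool) :
    hammingDist (reflectGray g (2 ^ (m + 1) - 1)) (reflectGray g 0) = 1 := by
  have := Nat.two_pow_pos m
  unfold reflectGray
  rw [if_neg (by rw [pow_succ]; omega), if_pos this]
  simp [hammingDist_cons]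

theorem exists_gray_path (m : ℕ) : ∃ g : ℕ → Fin m → Bool,
    (∀ i j, i < 2 ^ m → j < 2 ^ m → g i = g j → i = j) ∧
      ∀ i, i + 1 < 2 ^ m → hammingDist (g i) (g (i + 1)) = 1 := by
  induction m with
  | zero => exact ⟨fun _ _ => false, by simp, by simp⟩
  | succ m ih =>
    obtain ⟨g, h1, h2⟩ := ih
    exact ⟨reflectGray g, reflectGray_ne h1, hammingDist_reflectGray h2⟩

/-- A Hamiltonian cycle of the hypercube, as a periodic sequence. -/
theorem exists_gray_cycle (m : ℕ) (hm : 1 ≤ m) : ∃ u : ℕ → Fin m → Bool,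
    (∀ i, u (i + 2 ^ m) = u i) ∧ (∀ i, hammingDist (u i) (u (i + 1)) = 1) ∧
      ∀ i j, i < j → j < i + 2 ^ m → u i ≠ u j := by
  obtain ⟨m, rfl⟩ := Nat.exists_eq_add_of_le' hm
  obtain ⟨g, h1, h2⟩ := exists_gray_path m
  have hpos := Nat.two_pow_pos (m + 1)
  refine ⟨fun i => reflectGray g (i % 2 ^ (m + 1)), fun i => by simp, fun i => ?_,
    fun i j hij hj h => ?_⟩
  · have hlt := Nat.mod_lt i hpos
    by_cases hi : i % 2 ^ (m + 1) + 1 < 2 ^ (m + 1)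
    · have : (i + 1) % 2 ^ (m + 1) = i % 2 ^ (m + 1) + 1 := by
        rw [Nat.add_mod, Nat.mod_eq_of_lt (a := 1) (by omega), Nat.mod_eq_of_lt hi]
      simp only [this]
      exact hammingDist_reflectGray h2 _ hi
    · have h3 : i % 2 ^ (m + 1) = 2 ^ (m + 1) - 1 := by omega
      have h4 : (i + 1) % 2 ^ (m + 1) = 0 := by
        rw [← Nat.mod_add_mod, h3, Nat.sub_add_cancel hpos, Nat.mod_self]
      simp only [h3, h4]
      exact hammingDist_reflectGray_last_first g
  · have := reflectGray_ne h1 _ _ (Nat.mod_lt _ hpos) (Nat.mod_lt _ hpos) h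
    have hd : 2 ^ (m + 1) ∣ j - i := (Nat.modEq_iff_dvd' hij.le).1 this
    exact absurd (Nat.le_of_dvd (by omega) hd) (by omega)

/-- The number of times before `t` that are congruent to `σ` modulo `T + 1`, for `σ ≤ T`. -/
def slotCount (T σ t : ℕ) : ℕ := (t + (T - σ)) / (T + 1)

theorem slotCount_eq {T σ : ℕ} (hσ : σ ≤ T) (t : ℕ) :
    slotCount T σ t = t / (T + 1) + if σ < t % (T + 1) then 1 else 0 := by
  unfold slotCount
  have h1 := Nat.div_add_mod t (T + 1)
  have h2 := Nat.mod_lt t (Nat.succ_pos T)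
  generalize t / (T + 1) = q at *
  generalize t % (T + 1) = r at *
  rw [← h1, add_assoc, Nat.mul_add_div (Nat.succ_pos T)]
  split_ifs with h
  · rw [Nat.div_eq_of_lt_le] <;> omega
  · rw [Nat.div_eq_of_lt (by omega)]

theorem slotCount_succ {T σ : ℕ} (hσ : σ ≤ T) (t : ℕ) :
    slotCount T σ (t + 1) = slotCount T σ t + if σ = t % (T + 1) then 1 else 0 := by
  have h1 := Nat.div_add_mod t (T + 1)
  have h2 := Nat.mod_lt t (Nat.succ_pos T)
  rw [slotCount_eq hσ t]
  unfold slotCount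
  generalize t / (T + 1) = q at *
  generalize t % (T + 1) = r at *
  rw [← h1, add_assoc, add_assoc, Nat.mul_add_div (Nat.succ_pos T), add_assoc]
  congr 1
  split_ifs
  · omega
  · rw [Nat.div_eq_of_lt_le] <;> omega
  · rw [Nat.div_eq_of_lt_le] <;> omega
  · rw [Nat.div_eq_of_lt (by omega)]

theorem slotCount_add_mul (T σ t n : ℕ) :
    slotCount T σ (t + n * (T + 1)) = slotCount T σ t + n := by
  unfold slotCount
  rw [add_right_comm, Nat.add_mul_div_right _ _ (Nat.succ_pos T)]

theorem slotCount_mono (T σ : ℕ) : Monotone (slotCount T σ) := fun _ _ h =>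
  Nat.div_le_div_right (by omega)

theorem sum_slotCount (T t : ℕ) : ∑ σ : Fin (T + 1), slotCount T σ t = t := by
  induction t with
  | zero =>
    refine Finset.sum_eq_zero fun σ _ => Nat.div_eq_of_lt (by omega)
  | succ t ih =>
    have h2 := Nat.mod_lt t (Nat.succ_pos T)
    rw [Finset.sum_congr rfl fun σ _ => slotCount_succ (Nat.le_of_lt_succ σ.2) t,
      Finset.sum_add_distrib, ih, Finset.sum_eq_single ⟨t % (T + 1), h2⟩]
    · simp
    · intro b _ hb
      rw [if_neg fun h => hb (Fin.ext h)]
    · simp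

/-- Any two times leave one of three consecutive blocks of slots uninterrupted. -/
theorem exists_block (B t t' : ℕ) : ∃ β < 3, ∃ e e', ∀ a, β * B ≤ a → a < (β + 1) * B →
    slotCount (3 * B) (a + 1) t = e ∧ slotCount (3 * B) (a + 1) t' = e' := by
  have key : ∀ t, ∃ γ, ∀ β < 3, β ≠ γ → ∃ e, ∀ a, β * B ≤ a → a < (β + 1) * B →
      slotCount (3 * B) (a + 1) t = e := by
    intro t
    set r := t % (3 * B + 1) with hr
    refine ⟨if r ≤ B then 0 else if r ≤ 2 * B then 1 else 2, fun β hβ hne => ?_⟩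
    refine ⟨t / (3 * B + 1) + if β * B + 1 < r then 1 else 0, fun a h1 h2 => ?_⟩
    have hlt := Nat.mod_lt t (Nat.succ_pos (3 * B))
    rw [slotCount_eq (by interval_cases β <;> omega), ← hr]
    congr 2
    rw [eq_iff_iff]
    interval_cases β <;> split_ifs at hne <;> omega
  obtain ⟨γ, h⟩ := key t
  obtain ⟨γ', h'⟩ := key t'
  obtain ⟨β, hβ, h1, h2⟩ : ∃ β < 3, β ≠ γ ∧ β ≠ γ' := by
    by_contra! hc
    have := hc 0; have := hc 1; have := hc 2
    omega
  obtain ⟨e, he⟩ := h β hβ h1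
  obtain ⟨e', he'⟩ := h' β hβ h2
  exact ⟨β, hβ, e, e', fun a h1 h2 => ⟨he a h1 h2, he' a h1 h2⟩⟩

/-- The vertex at time `t` of the circuit in which coordinate block `0` runs through `u`, and the
pair of coordinates indexed by `a` encodes entry `a` of `v` so that it changes by a single flip
at each step. -/
def circuitWord {m T : ℕ} (u : ℕ → Fin m → Bool) (v : ℕ → Fin T → Bool) (t : ℕ) :
    Fin m ⊕ (Fin T × Bool) → Bool
  | .inl j => u (slotCount T 0 t) j
  | .inr (a, b) => v (slotCount T (a + 1) t) a ^^ (b && decide (slotCount T (a + 1) t % 2 = 1))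

theorem hammingDist_circuitWord {m T : ℕ} (u : ℕ → Fin m → Bool) (v : ℕ → Fin T → Bool)
    (t t' : ℕ) :
    hammingDist (circuitWord u v t) (circuitWord u v t') =
      hammingDist (u (slotCount T 0 t)) (u (slotCount T 0 t')) +
        ∑ a : Fin T, ∑ b : Bool,
          (circuitWord u v t (.inr (a, b)) ^^ circuitWord u v t' (.inr (a, b))).toNat := by
  rw [hammingDist_eq_sum, hammingDist_eq_sum, Fintype.sum_sum_type, Fintype.sum_prod_type]
  rfl

theorem hammingDist_circuitWord_near {m T : ℕ} {u : ℕ → Fin m → Bool} (v : ℕ → Fin T → Bool)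
    (hu : ∀ i, hammingDist (u i) (u (i + 1)) = 1) {t t' : ℕ} (h : t ≤ t')
    (h' : t' ≤ t + (T + 1)) :
    hammingDist (circuitWord u v t) (circuitWord u v t') = t' - t := by
  have hs : ∀ σ, slotCount T σ t' = slotCount T σ t ∨
      slotCount T σ t' = slotCount T σ t + 1 := fun σ => by
    have h1 := slotCount_mono T σ h
    have h2 := slotCount_mono T σ h'
    have h3 := slotCount_add_mul T σ t 1
    rw [one_mul] at h3
    omega
  have e1 : hammingDist (u (slotCount T 0 t)) (u (slotCount T 0 t')) + slotCount T 0 t =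
      slotCount T 0 t' := by
    rcases hs 0 with h | h <;> rw [h]
    · simp
    · rw [hu, add_comm]
  have e2 : ∀ a : Fin T, (∑ b : Bool,
      (circuitWord u v t (.inr (a, b)) ^^ circuitWord u v t' (.inr (a, b))).toNat) +
        slotCount T (a + 1) t = slotCount T (a + 1) t' := fun a => by
    simp only [circuitWord, Fintype.sum_bool]
    rcases hs (a + 1) with h | h <;> rw [h]
    · simp
    · generalize slotCount T (a + 1) t = n
      rcases Nat.mod_two_eq_zero_or_one n with h2 | h2 <;>
        cases v n a <;> cases v (n + 1) a <;> simp [Nat.add_mod, h2, add_comm]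
  have s1 := sum_slotCount T t
  have s2 := sum_slotCount T t'
  rw [Fin.sum_univ_succ] at s1 s2
  simp only [Fin.val_zero, Fin.val_succ] at s1 s2
  rw [← e1, ← Finset.sum_congr rfl fun a _ => e2 a, Finset.sum_add_distrib] at s2
  rw [hammingDist_circuitWord]
  omega

theorem le_hammingDist_circuitWord_far {m B k M : ℕ} {u : ℕ → Fin m → Bool}
    {v : ℕ → Fin (3 * B) → Bool} (hu : ∀ i, hammingDist (u i) (u (i + 1)) = 1)
    (hv : ∀ i j, i < j → j < i + M → hammingDist (u i) (u j) ≤ k + 1 → ∀ β < 3,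
      k ≤ #{a : Fin (3 * B) | (β * B ≤ a ∧ a < (β + 1) * B) ∧ v i a ≠ v j a}) {t t' : ℕ}
    (hB : 0 < B) (h : t + (3 * B + 1) < t') (h' : t' + (3 * B + 1) < t + M * (3 * B + 1)) :
    k ≤ hammingDist (circuitWord u v t) (circuitWord u v t') := by
  obtain ⟨β, hβ, e, e', he⟩ := exists_block B t t'
  have hβ3 : (β + 1) * B ≤ 3 * B := Nat.mul_le_mul_right _ hβ
  have hβB : β * B < (β + 1) * B := by rw [add_mul]; omega
  have close : ∀ t e, slotCount (3 * B) (β * B + 1) t = e →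
      hammingDist (u e) (u (slotCount (3 * B) 0 t)) ≤ 1 := by
    rintro t _ rfl
    rw [slotCount_eq (by omega), slotCount_eq (by omega)]
    split_ifs
    · simp
    · omega
    · exact (hu _).le
    · simp
  obtain ⟨h1, h2⟩ := he _ le_rfl hβB
  have c1 := close t e h1
  have c2 := close t' e' h2
  have hlt : e < e' := by
    have h3 := slotCount_add_mul (3 * B) (β * B + 1) t 1
    have h4 := slotCount_mono (3 * B) (β * B + 1) h.le
    rw [one_mul] at h3
    omega
  have hgt : e' < e + M := by
    have h3 := slotCount_add_mul (3 * B) (β * B + 1) t' 1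
    have h4 := slotCount_mono (3 * B) (β * B + 1) h'.le
    rw [slotCount_add_mul] at h4
    rw [one_mul] at h3
    omega
  by_cases hd : hammingDist (u e) (u e') ≤ k + 1
  · refine (hv e e' hlt hgt hd β hβ).trans ?_
    rw [hammingDist_circuitWord, Finset.card_filter]
    refine le_add_left (Finset.sum_le_sum fun a _ => ?_)
    split_ifs with ha
    · obtain ⟨h3, h4⟩ := he a ha.1.1 ha.1.2
      simp only [Fintype.sum_bool, circuitWord, h3, h4]
      refine le_add_left ?_
      have := ha.2
      revert this
      cases v e a <;> cases v e' a <;> simp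
    · exact Nat.zero_le _
  · have t1 := hammingDist_triangle (u e) (u (slotCount (3 * B) 0 t)) (u e')
    have t2 := hammingDist_triangle (u (slotCount (3 * B) 0 t)) (u (slotCount (3 * B) 0 t')) (u e')
    rw [hammingDist_comm (u (slotCount (3 * B) 0 t')) (u e')] at t2
    rw [hammingDist_circuitWord]
    omega

theorem circuitWord_add_period {m T M : ℕ} {u : ℕ → Fin m → Bool} {v : ℕ → Fin T → Bool}
    (hM : Even M) (hu : ∀ i, u (i + M) = u i) (hv : ∀ i, v (i + M) = v i) (t : ℕ) :
    circuitWord u v (t + M * (T + 1)) = circuitWord u v t := by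
  ext (j | ⟨a, b⟩)
  · simp [circuitWord, slotCount_add_mul, hu]
  · have := Nat.even_iff.1 hM
    simp [circuitWord, slotCount_add_mul, hv, Nat.add_mod, this]

theorem val_sub_of_val_lt {N : ℕ} [NeZero N] {i j : ZMod N} (h : i.val < j.val) :
    (j - i).val = j.val - i.val ∧ (i - j).val = N - (j.val - i.val) := by
  have h1 := ZMod.val_sub h.le
  refine ⟨h1, ?_⟩
  have hne : NeZero (j - i) := ⟨fun h0 => by rw [h0, ZMod.val_zero] at h1; omega⟩
  rw [← neg_sub j i, ZMod.val_neg_of_ne_zero, h1]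

/-- A criterion for a periodic sequence to define a circuit code, up to relabelling coordinates. -/
theorem isCircuitCode_of_periodic {ι : Type*} [Fintype ι] {d k N L : ℕ} (e : Fin d ≃ ι)
    (hk : 1 ≤ k) (hN : 3 ≤ N) (hL : 1 ≤ L) (X : ℕ → ι → Bool) (hX : ∀ t, X (t + N) = X t)
    (near : ∀ t t', t ≤ t' → t' ≤ t + L → hammingDist (X t) (X t') = t' - t)
    (far : ∀ t t', t + L < t' → t' + L < t + N → k ≤ hammingDist (X t) (X t')) :
    IsCircuitCode d k N fun i j => X i.val (e j) := by
  have : NeZero N := ⟨by omega⟩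
  have hdist : ∀ t t', hammingDist (fun j => X t (e j)) (fun j => X t' (e j)) =
      hammingDist (X t) (X t') := fun t t' => by
    rw [hammingDist_eq_sum, hammingDist_eq_sum]
    exact Equiv.sum_comp e fun i => (X t i ^^ X t' i).toNat
  have hlt : ∀ i j : ZMod N, i.val < j.val →
      min (cycDist i j) k ≤ hammingDist (X i.val) (X j.val) := fun i j hij => by
    obtain ⟨h1, h2⟩ := val_sub_of_val_lt hij
    have hj := ZMod.val_lt j
    rw [cycDist, h1, h2]
    by_cases c1 : j.val ≤ i.val + L
    · rw [near _ _ hij.le c1]; omega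
    by_cases c2 : i.val + N ≤ j.val + L
    · rw [← hX i.val, hammingDist_comm, near _ _ (by omega) c2]; omega
    · exact (min_le_right _ _).trans (far _ _ (by omega) (by omega))
  have hall : ∀ i j : ZMod N, min (cycDist i j) k ≤ hammingDist (X i.val) (X j.val) := by
    intro i j
    rcases lt_trichotomy i.val j.val with h | h | h
    · exact hlt i j h
    · rw [ZMod.val_injective N h]; simp [cycDist]
    · rw [hammingDist_comm, cycDist, min_comm (j - i).val]
      exact hlt j i h
  refine ⟨hN, fun i j hij => ?_, fun i => ?_, fun i j => ?_⟩
  · by_contra hne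
    have h1 := hall i j
    rw [← hdist, show (fun a => X i.val (e a)) = fun a => X j.val (e a) from hij,
      hammingDist_self, cycDist] at h1
    have h2 : (j - i).val ≠ 0 := fun h => hne (sub_eq_zero.1 ((ZMod.val_eq_zero _).1 h)).symm
    have h3 : (i - j).val ≠ 0 := fun h => hne (sub_eq_zero.1 ((ZMod.val_eq_zero _).1 h))
    omega
  · rw [hdist]
    have h1 : (1 : ZMod N).val = 1 := ZMod.val_one'' (by omega)
    have : X (i + 1).val = X (i.val + 1) := by
      by_cases h : i.val + 1 < N
      · rw [ZMod.val_add_of_lt (by rwa [h1]), h1]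
      · have h2 := ZMod.val_lt i
        have h3 : i.val + 1 = 0 + N := by omega
        rw [ZMod.val_add, h1, h3, hX, zero_add, Nat.mod_self]
    rw [this, near _ _ (by omega) (by omega)]
    omega
  · rw [hdist]
    exact hall i j

/-- Nonzero integer weights on at most `K` distinct points cannot annihilate all power sums of
degree less than `K`. -/
theorem exists_sum_mul_pow_ne_zero {m K : ℕ} (ε : Fin m → ℤ) (h0 : ε ≠ 0)
    (hK : #{j | ε j ≠ 0} ≤ K) : ∃ l < K, ∑ j, ε j * (j : ℤ) ^ l ≠ 0 := by
  by_contra! h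
  obtain ⟨j₀, hj₀⟩ := Function.ne_iff.1 h0
  set S : Finset (Fin m) := {j | ε j ≠ 0} with hS
  have hmem : j₀ ∈ S := by simpa [hS] using hj₀
  let p : Polynomial ℤ := ∏ j ∈ S.erase j₀, (Polynomial.X - Polynomial.C (j : ℤ))
  have hdeg : p.natDegree < K := by
    have h1 : p.natDegree = (S.erase j₀).card := by
      simp only [p]
      rw [Polynomial.natDegree_finsetProd_X_sub_C_eq_card]
    have h2 := Finset.card_erase_lt_of_mem hmem
    omega
  have hz : ∑ j, ε j * p.eval (j : ℤ) = 0 := by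
    simp_rw [Polynomial.eval_eq_sum_range' hdeg, Finset.mul_sum]
    rw [Finset.sum_comm]
    refine Finset.sum_eq_zero fun l hl => ?_
    simp_rw [mul_left_comm (ε _)]
    rw [← Finset.mul_sum, h l (Finset.mem_range.1 hl), mul_zero]
  rw [Finset.sum_eq_single j₀] at hz
  · rcases mul_eq_zero.1 hz with h1 | h1
    · exact hj₀ h1
    · rw [Polynomial.eval_prod, Finset.prod_eq_zero_iff] at h1
      obtain ⟨j, hj, h2⟩ := h1
      refine (Finset.mem_erase.1 hj).1 (Fin.ext ?_)
      simp at h2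
      omega
  · intro j _ hj
    by_cases hjS : j ∈ S
    · rw [Polynomial.eval_prod, Finset.prod_eq_zero (Finset.mem_erase.2 ⟨hj, hjS⟩) (by simp),
        mul_zero]
    · have : ε j = 0 := by simpa [hS] using hjS
      simp [this]
  · simp

/-- A colouring of the hypercube with few colours that separates distinct vertices at distance at
most `K`. -/
theorem exists_coloring {m K s : ℕ} (hs : (m ^ K + 1) ^ K ≤ 2 ^ s) :
    ∃ c : (Fin m → Bool) → Fin s → Bool,
      ∀ x y, x ≠ y → hammingDist x y ≤ K → c x ≠ c y := by
  have hbound : ∀ (x : Fin m → Bool) (l : Fin K),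
      ∑ j, (x j).toNat * (j : ℕ) ^ (l : ℕ) < m ^ K + 1 := fun x l => by
    refine Nat.lt_succ_of_le ?_
    calc ∑ j : Fin m, (x j).toNat * (j : ℕ) ^ (l : ℕ) ≤ ∑ _j : Fin m, m ^ (K - 1) := by
          refine Finset.sum_le_sum fun j _ => ?_
          have hj := j.2
          calc (x j).toNat * (j : ℕ) ^ (l : ℕ) ≤ 1 * m ^ (l : ℕ) :=
                Nat.mul_le_mul (Bool.toNat_le _) (Nat.pow_le_pow_left hj.le _)
            _ ≤ m ^ (K - 1) := by
                rw [one_mul]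
                exact Nat.pow_le_pow_right (by omega) (by omega)
      _ = m ^ K := by
          obtain ⟨n, rfl⟩ := Nat.exists_eq_add_of_lt l.pos
          simp [pow_succ, mul_comm]
  obtain ⟨φ⟩ : Nonempty ((Fin K → Fin (m ^ K + 1)) ↪ (Fin s → Bool)) :=
    Function.Embedding.nonempty_of_card_le (by simpa using hs)
  refine ⟨fun x => φ fun l => ⟨_, hbound x l⟩, fun x y hne hd h => ?_⟩
  have hne' : ∀ j, x j ≠ y j ↔ ((x j).toNat : ℤ) - (y j).toNat ≠ 0 := fun j => by
    cases x j <;> cases y j <;> simp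
  obtain ⟨l, hl, hsum⟩ := exists_sum_mul_pow_ne_zero (K := K)
    (fun j => ((x j).toNat : ℤ) - (y j).toNat)
    (fun h0 => hne (funext fun j => by
      by_contra hj
      exact (hne' j).1 hj (congrFun h0 j)))
    (by simp only [← hne']; exact hd)
  apply hsum
  have h1 := congrFun (φ.injective h) ⟨l, hl⟩
  have h2 : ∑ j, (x j).toNat * (j : ℕ) ^ l = ∑ j, (y j).toNat * (j : ℕ) ^ l := by
    simpa using h1
  simp_rw [sub_mul]
  rw [Finset.sum_sub_distrib, sub_eq_zero]
  exact_mod_cast h2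

/-- Repeating each bit of two distinct words `k` times per block makes them differ in `k` places
of each of three blocks. -/
theorem le_card_repeat_ne {k s : ℕ} {x y : Fin s → Bool} (h : x ≠ y) (hs : 0 < s) {β : ℕ}
    (hβ : β < 3) :
    k ≤ #{a : Fin (3 * (k * s)) | (β * (k * s) ≤ a ∧ a < (β + 1) * (k * s)) ∧
      x ⟨a % s, Nat.mod_lt _ hs⟩ ≠ y ⟨a % s, Nat.mod_lt _ hs⟩} := by
  obtain ⟨b, hb⟩ := Function.ne_iff.1 h
  have hlt : ∀ ρ : Fin k, ρ * s + b < k * s := fun ρ => by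
    have := Nat.mul_le_mul_right s (Nat.succ_le_of_lt ρ.2)
    rw [Nat.succ_mul] at this
    omega
  have hβ' := Nat.mul_le_mul_right (k * s) (Nat.succ_le_of_lt hβ)
  rw [Nat.succ_mul] at hβ'
  let f : Fin k → Fin (3 * (k * s)) := fun ρ =>
    ⟨β * (k * s) + (ρ * s + b), by have := hlt ρ; omega⟩
  have hf : Function.Injective f := fun ρ ρ' h => by
    simp only [f, Fin.mk.injEq, add_right_inj, add_left_inj] at h
    exact Fin.ext (Nat.eq_of_mul_eq_mul_right hs h)
  calc k = (Finset.univ.map ⟨f, hf⟩).card := by simp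
    _ ≤ _ := Finset.card_le_card fun a ha => by
      obtain ⟨ρ, -, rfl⟩ := Finset.mem_map.1 ha
      have h1 : (β * (k * s) + (ρ * s + b)) % s = b := by
        rw [← mul_assoc, ← add_assoc, ← add_mul, Nat.mul_add_mod_of_lt b.2]
      have := hlt ρ
      simp only [Finset.mem_filter, Finset.mem_univ, true_and, Function.Embedding.coeFn_mk, f, h1,
        add_mul, one_mul]
      exact ⟨⟨by omega, by omega⟩, hb⟩

theorem exists_isCircuitCode {k m s : ℕ} (hk : 1 ≤ k) (hm : 1 ≤ m) (hs0 : 0 < s)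
    (hs : (m ^ (k + 1) + 1) ^ (k + 1) ≤ 2 ^ s) :
    ∃ x, IsCircuitCode (m + 6 * (k * s)) k (2 ^ m * (3 * (k * s) + 1)) x := by
  obtain ⟨u, u1, u2, u3⟩ := exists_gray_cycle m hm
  obtain ⟨c, hc⟩ := exists_coloring hs
  have hB : 0 < k * s := Nat.mul_pos hk hs0
  have hM : 2 ≤ 2 ^ m := by simpa using Nat.pow_le_pow_right two_pos hm
  let v : ℕ → Fin (3 * (k * s)) → Bool := fun i a => c (u i) ⟨a % s, Nat.mod_lt _ hs0⟩
  let e : Fin (m + 6 * (k * s)) ≃ Fin m ⊕ (Fin (3 * (k * s)) × Bool) :=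
    Fintype.equivOfCardEq (by simp; ring)
  refine ⟨_, isCircuitCode_of_periodic e hk ?_
    (Nat.succ_pos (3 * (k * s))) (circuitWord u v) ?_ ?_ ?_⟩
  · nlinarith
  · exact circuitWord_add_period (Nat.even_pow.2 ⟨even_two, by omega⟩) u1
      fun i => by simp only [v, u1]
  · exact fun t t' => hammingDist_circuitWord_near v u2
  · exact fun t t' => le_hammingDist_circuitWord_far u2
      (fun i j hij hj hd β hβ => le_card_repeat_ne (hc _ _ (u3 i j hij hj) hd) hs0 hβ) hB

theorem IsCircuitCode.le_two_pow {d k N : ℕ} {x : ZMod N → Fin d → Bool}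
    (h : IsCircuitCode d k N x) : N ≤ 2 ^ d := by
  have : NeZero N := ⟨by have := h.1; omega⟩
  simpa using Fintype.card_le_of_injective x h.2.1

theorem K_le_two_pow (d k : ℕ) : K d k ≤ 2 ^ d :=
  csSup_le' fun _ ⟨_, hx⟩ => hx.le_two_pow

theorem IsCircuitCode.le_K {d k N : ℕ} {x : ZMod N → Fin d → Bool}
    (h : IsCircuitCode d k N x) : N ≤ K d k :=
  le_csSup ⟨2 ^ d, fun _ ⟨_, hx⟩ => hx.le_two_pow⟩ ⟨x, h⟩

theorem two_pow_sub_le_K {k d : ℕ} (hk : 1 ≤ k)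
    (hd : 6 * (k * ((k + 2) ^ 2 * (Nat.log 2 d + 1))) < d) :
    2 ^ (d - 6 * (k * ((k + 2) ^ 2 * (Nat.log 2 d + 1)))) ≤ K d k := by
  set q := Nat.log 2 d + 1 with hq
  set s := (k + 2) ^ 2 * q with hs
  obtain ⟨m, hm⟩ := Nat.exists_eq_add_of_lt hd
  have hdq : d < 2 ^ q := Nat.lt_pow_succ_log_self one_lt_two d
  have hcol : ((m + 1) ^ (k + 1) + 1) ^ (k + 1) ≤ 2 ^ s := by
    have h1 : (m + 1) ^ (k + 1) + 1 ≤ 2 ^ (q * (k + 1)) := by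
      rw [pow_mul]
      exact Nat.pow_lt_pow_left (by omega) (by omega)
    calc _ ≤ (2 ^ (q * (k + 1))) ^ (k + 1) := Nat.pow_le_pow_left h1 _
      _ = 2 ^ (q * (k + 1) * (k + 1)) := (pow_mul _ _ _).symm
      _ ≤ 2 ^ s := Nat.pow_le_pow_right two_pos (by rw [hs]; nlinarith)
  obtain ⟨x, hx⟩ := exists_isCircuitCode hk (Nat.succ_pos m) (by positivity) hcol
  have h3 := hx.le_K
  rw [show m.succ + 6 * (k * s) = d by omega] at h3
  rw [show d - 6 * (k * s) = m + 1 by omega]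
  exact (Nat.le_mul_of_pos_right _ (Nat.succ_pos _)).trans h3

theorem tendsto_natLog_div : Filter.Tendsto (fun d : ℕ => ((Nat.log 2 d + 1 : ℕ) : ℝ) / d)
    Filter.atTop (nhds 0) := by
  have h1 : Filter.Tendsto (fun d : ℕ => Real.logb 2 d / d + 1 / (d : ℝ)) Filter.atTop
      (nhds 0) := by
    have h2 : Filter.Tendsto (fun d : ℕ => Real.log d / (d : ℝ)) Filter.atTop (nhds 0) :=
      (Real.isLittleO_log_id_atTop.tendsto_div_nhds_zero).comp tendsto_natCast_atTop_atTop
    have h3 := (h2.div_const (Real.log 2)).add tendsto_one_div_atTop_nhds_zero_nat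
    simp only [zero_div, add_zero] at h3
    refine h3.congr fun d => ?_
    rw [Real.logb, div_right_comm]
  refine squeeze_zero (fun d => by positivity) (fun d => ?_) h1
  rw [← add_div]
  push_cast
  gcongr
  exact Real.natLog_le_logb d 2

/-- For every `k ≥ 1`, the limit `ν(k) = lim_{d→∞} (log₂ K(d,k))/d` exists and
equals `1`. -/
theorem stmt_1 (k : ℕ) (hk : 1 ≤ k) :
    Filter.Tendsto (fun d : ℕ => Real.logb 2 (K d k) / d)
      Filter.atTop (nhds 1) := by
  set r : ℕ → ℕ := fun d => 6 * (k * ((k + 2) ^ 2 * (Nat.log 2 d + 1))) with hr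
  have hr0 : Filter.Tendsto (fun d : ℕ => (r d : ℝ) / d) Filter.atTop (nhds 0) := by
    have h := tendsto_natLog_div.const_mul ((6 * (k * (k + 2) ^ 2) : ℕ) : ℝ)
    rw [mul_zero] at h
    refine h.congr fun d => ?_
    simp only [hr]
    push_cast
    ring
  have hev : ∀ᶠ d : ℕ in Filter.atTop, 0 < d ∧ r d < d := by
    filter_upwards [hr0.eventually_lt_const one_pos, Filter.eventually_gt_atTop 0] with d h1 h2
    rw [div_lt_one (by exact_mod_cast h2)] at h1
    exact ⟨h2, by exact_mod_cast h1⟩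
  have hlow : Filter.Tendsto (fun d : ℕ => 1 - (r d : ℝ) / d) Filter.atTop (nhds 1) := by
    simpa using hr0.const_sub 1
  refine tendsto_of_tendsto_of_tendsto_of_le_of_le' hlow tendsto_const_nhds ?_ ?_
  · filter_upwards [hev] with d ⟨h0, h1⟩
    have hd : (0 : ℝ) < d := by exact_mod_cast h0
    have h2 : (2 : ℝ) ^ (d - r d) ≤ K d k := by exact_mod_cast two_pow_sub_le_K hk h1
    have h3 := Real.logb_le_logb_of_le one_lt_two (by positivity) h2
    rw [Real.logb_pow, Real.logb_self_eq_one one_lt_two, mul_one, Nat.cast_sub h1.le] at h3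
    rw [le_div_iff₀ hd, sub_mul, div_mul_cancel₀ _ hd.ne', one_mul]
    exact h3
  · filter_upwards [hev] with d ⟨h0, h1⟩
    have hd : (0 : ℝ) < d := by exact_mod_cast h0
    have hpos : 0 < K d k := (Nat.two_pow_pos _).trans_le (two_pow_sub_le_K hk h1)
    have h2 : (K d k : ℝ) ≤ 2 ^ d := by exact_mod_cast K_le_two_pow d k
    have h3 := Real.logb_le_logb_of_le one_lt_two (by exact_mod_cast hpos) h2
    rw [Real.logb_pow, Real.logb_self_eq_one one_lt_two, mul_one] at h3
    exact (div_le_one hd).2 h3
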